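/- For all integers k ≥ 3 and N ≥ 1, the number of 2-regular, k-noncrossing set partitions of [N] equals the number of k-noncrossing braids over [N−1] that contain no loop (i,i). -/

import Mathlib

/-- `i` and `j` lie in a common block of the partition `P`. -/
def SameBlock {N : ℕ} (P : Finpartition (Finset.univ : Finset (Fin N))) (i j : Fin N) : Prop :=
  ∃ B ∈ P.parts, i ∈ B ∧ j ∈ B

/-- `(i,j)` is an arc of the standard representation of the partition `P`:
`i < j` lie in a common block with no element of that block strictly between them. -/
def IsArc {N : ℕ} (P : Finpartition (Finset.univ : Finset (Fin N))) (i j : Fin N) : Prop :=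
  i < j ∧ SameBlock P i j ∧ ∀ l : Fin N, i < l → l < j → ¬ SameBlock P i l

/-- The partition `P` has a `k`-crossing: arcs `(i₁,j₁),…,(i_k,j_k)` with
`i₁ < … < i_k < j₁ < … < j_k`. -/
def PartitionHasKCrossing {N : ℕ} (k : ℕ)
    (P : Finpartition (Finset.univ : Finset (Fin N))) : Prop :=
  ∃ a b : Fin k → Fin N, StrictMono a ∧ StrictMono b ∧
    (∀ m, IsArc P (a m) (b m)) ∧ ∀ m m', a m < b m'

/-- A `k`-noncrossing set partition. -/
def IsKNoncrossingPartition {N : ℕ} (k : ℕ)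
    (P : Finpartition (Finset.univ : Finset (Fin N))) : Prop :=
  ¬ PartitionHasKCrossing k P

/-- A `2`-regular partition: distinct elements of a common block differ by at least `2`. -/
def IsTwoRegular {N : ℕ} (P : Finpartition (Finset.univ : Finset (Fin N))) : Prop :=
  ∀ i j : Fin N, SameBlock P i j → i ≠ j → 2 ≤ |(i : ℤ) - (j : ℤ)|

/-- A braid over `[M]`, given as its finite set of arcs `(i,j)` with `i ≤ j`:
every vertex is the smaller endpoint of at most one arc and the larger endpoint
of at most one arc. -/
def IsBraid {M : ℕ} (B : Finset (Fin M × Fin M)) : Prop :=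
  (∀ p ∈ B, p.1 ≤ p.2) ∧
  (∀ p ∈ B, ∀ q ∈ B, p.1 = q.1 → p = q) ∧
  (∀ p ∈ B, ∀ q ∈ B, p.2 = q.2 → p = q)

/-- The braid `B` has a `k`-crossing: arcs `(i₁,j₁),…,(i_k,j_k)` with
`i₁ < … < i_k ≤ j₁ < … < j_k`. -/
def BraidHasKCrossing {M : ℕ} (k : ℕ) (B : Finset (Fin M × Fin M)) : Prop :=
  ∃ a b : Fin k → Fin M, StrictMono a ∧ StrictMono b ∧
    (∀ m, (a m, b m) ∈ B) ∧ ∀ m m', a m ≤ b m'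

/-- A `k`-noncrossing braid. -/
def IsKNoncrossingBraid {M : ℕ} (k : ℕ) (B : Finset (Fin M × Fin M)) : Prop :=
  IsBraid B ∧ ¬ BraidHasKCrossing k B

/-- The braid `B` contains a loop `(i,i)`. -/
def HasLoop {M : ℕ} (B : Finset (Fin M × Fin M)) : Prop := ∃ i, (i, i) ∈ B

section SameBlock

variable {N : ℕ} {P Q : Finpartition (Finset.univ : Finset (Fin N))} {i j l : Fin N}

theorem sameBlock_iff_mem_part : SameBlock P i j ↔ i ∈ P.part j :=
  P.mem_part_iff_exists.symm

theorem SameBlock.refl (P : Finpartition (Finset.univ : Finset (Fin N))) (i : Fin N) :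
    SameBlock P i i :=
  sameBlock_iff_mem_part.2 (P.mem_part (Finset.mem_univ i))

theorem SameBlock.symm (h : SameBlock P i j) : SameBlock P j i := by
  obtain ⟨B, hB, hi, hj⟩ := h
  exact ⟨B, hB, hj, hi⟩

theorem SameBlock.trans (h : SameBlock P i j) (h' : SameBlock P j l) : SameBlock P i l := by
  obtain ⟨B, hB, hi, hj⟩ := h
  obtain ⟨C, hC, hj', hl⟩ := h'
  obtain rfl : B = C := P.eq_of_mem_parts hB hC hj hj'
  exact ⟨B, hB, hi, hl⟩

/-- A partition is determined by its common-block relation. -/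
theorem eq_of_sameBlock_iff (h : ∀ i j, SameBlock P i j ↔ SameBlock Q i j) : P = Q := by
  have key : ∀ P Q : Finpartition (Finset.univ : Finset (Fin N)),
      (∀ i j, SameBlock P i j ↔ SameBlock Q i j) → P.parts ⊆ Q.parts := by
    intro P Q h B hB
    obtain ⟨x, hx⟩ := P.nonempty_of_mem_parts hB
    have hpart : P.part x = Q.part x := by
      ext y
      rw [← sameBlock_iff_mem_part, ← sameBlock_iff_mem_part, h]
    rw [← P.part_eq_of_mem hB hx, hpart]
    exact Q.part_mem.2 (Finset.mem_univ x)
  exact Finpartition.ext ((key P Q h).antisymm (key Q P fun i j => (h i j).symm))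

theorem IsArc.left_unique (h : IsArc P i l) (h' : IsArc P j l) : i = j := by
  rcases lt_trichotomy i j with hij | hij | hij
  · exact (h.2.2 j hij h'.1 (h.2.1.trans h'.2.1.symm)).elim
  · exact hij
  · exact (h'.2.2 i hij h.1 (h'.2.1.trans h.2.1.symm)).elim

theorem IsArc.right_unique (h : IsArc P l i) (h' : IsArc P l j) : i = j := by
  rcases lt_trichotomy i j with hij | hij | hij
  · exact (h'.2.2 i h.1 hij h.2.1).elim
  · exact hij
  · exact (h.2.2 j h'.1 hij h'.2.1).elim

/-- Any element that is not the last of its block starts an arc that does not jump over a given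
later element of the block. -/
theorem SameBlock.exists_isArc_le (h : SameBlock P i j) (hij : i < j) :
    ∃ l, IsArc P i l ∧ l ≤ j := by
  classical
  let S := Finset.univ.filter fun l => i < l ∧ SameBlock P i l
  have hS : S.Nonempty := ⟨j, by simp [S, h, hij]⟩
  have hmem := S.min'_mem hS
  simp only [S, Finset.mem_filter, Finset.mem_univ, true_and] at hmem
  refine ⟨S.min' hS, ⟨hmem.1, hmem.2, fun m him hm hs => ?_⟩, S.min'_le j (by simp [S, h, hij])⟩
  exact hm.not_ge (S.min'_le m (by simp [S, him, hs]))

/-- The arcs of the standard representation of a block form a path through the block. -/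
theorem SameBlock.reflTransGen_isArc (h : SameBlock P i j) (hij : i ≤ j) :
    Relation.ReflTransGen (IsArc P) i j := by
  induction hn : (j : ℕ) - i using Nat.strong_induction_on generalizing i with
  | _ n ih =>
    rcases hij.eq_or_lt with rfl | hlt
    · exact .refl
    · obtain ⟨l, hl, hlj⟩ := h.exists_isArc_le hlt
      have hil : i < l := hl.1
      exact .head hl (ih (j - l) (by omega) (hl.2.1.symm.trans h) hlj rfl)

theorem SameBlock.of_reflTransGen_isArc (h : Relation.ReflTransGen (IsArc P) i j) :
    SameBlock P i j := by
  induction h with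
  | refl => exact .refl P i
  | tail _ h ih => exact ih.trans h.2.1

/-- A partition is determined by the arcs of its standard representation. -/
theorem eq_of_isArc_iff (h : ∀ i j, IsArc P i j ↔ IsArc Q i j) : P = Q := by
  have hPQ : IsArc P = IsArc Q := by
    ext i j
    exact h i j
  have key : ∀ i j, i ≤ j → (SameBlock P i j ↔ SameBlock Q i j) := fun i j hij =>
    ⟨fun h => .of_reflTransGen_isArc (hPQ ▸ h.reflTransGen_isArc hij),
      fun h => .of_reflTransGen_isArc (hPQ ▸ h.reflTransGen_isArc hij)⟩
  refine eq_of_sameBlock_iff fun i j => ?_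
  rcases le_total i j with hij | hij
  · exact key i j hij
  · exact ⟨fun h => ((key j i hij).1 h.symm).symm, fun h => ((key j i hij).2 h.symm).symm⟩

/-- `2`-regularity says that no arc joins two consecutive integers. -/
theorem isTwoRegular_iff :
    IsTwoRegular P ↔ ∀ i j, IsArc P i j → (i : ℕ) + 2 ≤ j := by
  constructor
  · intro h i j hij
    have hlt : (i : ℕ) < j := hij.1
    have := h i j hij.2.1 hij.1.ne
    rw [abs_of_nonpos (by omega)] at this
    omega
  · intro h i j hs hne
    rcases hne.lt_or_gt with hlt | hlt
    · obtain ⟨l, hl, hlj⟩ := hs.exists_isArc_le hlt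
      have := h i l hl
      rw [abs_of_nonpos (by omega)]
      omega
    · obtain ⟨l, hl, hlj⟩ := hs.symm.exists_isArc_le hlt
      have := h j l hl
      rw [abs_of_nonneg (by omega)]
      omega

end SameBlock

/-- Any set of increasing arcs in which each vertex starts at most one arc and ends at most one arc
is the standard representation of a partition. -/
theorem exists_finpartition_isArc_iff {N : ℕ} {R : Fin N → Fin N → Prop}
    (hlt : ∀ i j, R i j → i < j) (hleft : ∀ i j l, R i l → R j l → i = j)
    (hright : ∀ i j l, R l i → R l j → i = j) :
    ∃ P : Finpartition (Finset.univ : Finset (Fin N)), ∀ i j, IsArc P i j ↔ R i j := by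
  classical
  have hle : ∀ i j, Relation.ReflTransGen R i j → i ≤ j := by
    intro i j h
    induction h with
    | refl => exact le_rfl
    | tail _ h ih => exact ih.trans (hlt _ _ h).le
  let s : Setoid (Fin N) :=
    { r := fun i j => Relation.ReflTransGen R i j ∨ Relation.ReflTransGen R j i
      iseqv :=
        { refl := fun _ => .inl .refl
          symm := fun h => h.symm
          trans := by
            rintro x y z (hxy | hyx) (hyz | hzy)
            · exact .inl (hxy.trans hyz)
            · have := Relation.ReflTransGen.total_of_right_unique
                (r := Function.swap R) (fun a b c hab hac => hleft b c a hab hac)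
                hxy.swap hzy.swap
              exact this.symm.imp (fun h => h.swap) (fun h => h.swap)
            · exact Relation.ReflTransGen.total_of_right_unique
                (fun a b c hab hac => hright b c a hab hac) hyx hyz
            · exact .inr (hzy.trans hyx) } }
  have hsame : ∀ i j, i ≤ j →
      (SameBlock (Finpartition.ofSetoid s) i j ↔ Relation.ReflTransGen R i j) := by
    intro i j hij
    rw [sameBlock_iff_mem_part, Finpartition.mem_part_ofSetoid_iff_rel]
    refine ⟨?_, fun h => .inr h⟩
    rintro (h | h)
    · rw [hij.antisymm (hle _ _ h)]
    · exact h
  refine ⟨Finpartition.ofSetoid s, fun i j => ⟨fun ⟨hij, hs, hbetween⟩ => ?_, fun h => ?_⟩⟩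
  · rcases ((hsame i j hij.le).1 hs).cases_head with rfl | ⟨l, hil, hlj⟩
    · exact (lt_irrefl _ hij).elim
    · rcases (hle _ _ hlj).eq_or_lt with rfl | hlt'
      · exact hil
      · exact (hbetween l (hlt _ _ hil) hlt'
          ((hsame i l (hlt _ _ hil).le).2 (.single hil))).elim
  · refine ⟨hlt _ _ h, (hsame i j (hlt _ _ h).le).2 (.single h), fun l hil hlj hs => ?_⟩
    rcases ((hsame i l hil.le).1 hs).cases_head with rfl | ⟨m, him, hml⟩
    · exact lt_irrefl _ hil
    · rw [hright m j i him h] at hml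
      exact hlj.not_ge (hle _ _ hml)

section ShiftedArcs

variable {M : ℕ}

open scoped Classical in
/-- The arcs of a partition of `[M+1]`, with every larger endpoint moved down by one. -/
noncomputable def shiftedArcs (P : Finpartition (Finset.univ : Finset (Fin (M + 1)))) :
    Finset (Fin M × Fin M) :=
  Finset.univ.filter fun p => IsArc P p.1.castSucc p.2.succ

variable {P Q : Finpartition (Finset.univ : Finset (Fin (M + 1)))}

theorem mem_shiftedArcs {p : Fin M × Fin M} :
    p ∈ shiftedArcs P ↔ IsArc P p.1.castSucc p.2.succ := by
  simp [shiftedArcs]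

theorem exists_castSucc_succ_of_lt {i j : Fin (M + 1)} (h : i < j) :
    ∃ a b : Fin M, a.castSucc = i ∧ b.succ = j := by
  obtain ⟨a, ha⟩ := Fin.exists_castSucc_eq.2 (Fin.ne_last_of_lt h)
  obtain ⟨b, hb⟩ := Fin.exists_succ_eq.2 (Fin.ne_zero_of_lt h)
  exact ⟨a, b, ha, hb⟩

theorem eq_of_shiftedArcs_eq (h : shiftedArcs P = shiftedArcs Q) : P = Q := by
  refine eq_of_isArc_iff fun i j => ?_
  by_cases hij : i < j
  · obtain ⟨a, b, rfl, rfl⟩ := exists_castSucc_succ_of_lt hij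
    rw [← mem_shiftedArcs (p := (a, b)), ← mem_shiftedArcs (p := (a, b)), h]
  · exact ⟨fun h => (hij h.1).elim, fun h => (hij h.1).elim⟩

theorem isBraid_shiftedArcs (P : Finpartition (Finset.univ : Finset (Fin (M + 1)))) :
    IsBraid (shiftedArcs P) := by
  refine ⟨fun p hp => ?_, fun p hp q hq h => ?_, fun p hp q hq h => ?_⟩
  · exact Fin.castSucc_lt_succ_iff.1 (mem_shiftedArcs.1 hp).1
  · rw [mem_shiftedArcs] at hp hq
    rw [h] at hp
    exact Prod.ext h (Fin.succ_injective _ (hp.right_unique hq))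
  · rw [mem_shiftedArcs] at hp hq
    rw [h] at hp
    exact Prod.ext (Fin.castSucc_injective _ (hp.left_unique hq)) h

theorem exists_shiftedArcs_eq {B : Finset (Fin M × Fin M)} (hB : IsBraid B) :
    ∃ P, shiftedArcs P = B := by
  obtain ⟨hle, hleft, hright⟩ := hB
  obtain ⟨P, hP⟩ := exists_finpartition_isArc_iff
    (R := fun i j : Fin (M + 1) => ∃ p ∈ B, p.1.castSucc = i ∧ p.2.succ = j)
    (by
      rintro _ _ ⟨p, hp, rfl, rfl⟩
      exact Fin.castSucc_lt_succ_iff.2 (hle p hp))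
    (by
      rintro _ _ _ ⟨p, hp, rfl, rfl⟩ ⟨q, hq, rfl, h⟩
      rw [hright q hq p hp (Fin.succ_injective _ h)])
    (by
      rintro _ _ _ ⟨p, hp, rfl, rfl⟩ ⟨q, hq, h, rfl⟩
      rw [hleft q hq p hp (Fin.castSucc_injective _ h)])
  refine ⟨P, ?_⟩
  ext ⟨a, b⟩
  rw [mem_shiftedArcs, hP]
  constructor
  · rintro ⟨⟨a', b'⟩, hp, ha, hb⟩
    obtain rfl : a' = a := Fin.castSucc_injective _ ha
    obtain rfl : b' = b := Fin.succ_injective _ hb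
    exact hp
  · exact fun h => ⟨_, h, rfl, rfl⟩

theorem braidHasKCrossing_shiftedArcs_iff {k : ℕ} :
    BraidHasKCrossing k (shiftedArcs P) ↔ PartitionHasKCrossing k P := by
  constructor
  · rintro ⟨a, b, ha, hb, harc, hcross⟩
    exact ⟨fun m => (a m).castSucc, fun m => (b m).succ,
      fun _ _ h => Fin.castSucc_lt_castSucc_iff.2 (ha h),
      fun _ _ h => Fin.succ_lt_succ_iff.2 (hb h), fun m => mem_shiftedArcs.1 (harc m),
      fun m m' => Fin.castSucc_lt_succ_iff.2 (hcross m m')⟩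
  · rintro ⟨a, b, ha, hb, harc, hcross⟩
    choose a' b' ha' hb' using fun m => exists_castSucc_succ_of_lt (harc m).1
    obtain rfl : (fun m => (a' m).castSucc) = a := funext ha'
    obtain rfl : (fun m => (b' m).succ) = b := funext hb'
    exact ⟨a', b', fun _ _ h => Fin.castSucc_lt_castSucc_iff.1 (ha h),
      fun _ _ h => Fin.succ_lt_succ_iff.1 (hb h), fun m => mem_shiftedArcs.2 (harc m),
      fun m m' => Fin.castSucc_lt_succ_iff.1 (hcross m m')⟩

theorem not_hasLoop_shiftedArcs_iff : ¬ HasLoop (shiftedArcs P) ↔ IsTwoRegular P := by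
  rw [isTwoRegular_iff]
  constructor
  · intro h i j hij
    obtain ⟨a, b, rfl, rfl⟩ := exists_castSucc_succ_of_lt hij.1
    have hle : a ≤ b := Fin.castSucc_lt_succ_iff.1 hij.1
    have hlt : a < b := hle.lt_of_ne fun hab => h ⟨a, mem_shiftedArcs.2 (hab ▸ hij)⟩
    simp only [Fin.val_castSucc, Fin.val_succ]
    omega
  · rintro h ⟨i, hi⟩
    have := h _ _ (mem_shiftedArcs.1 hi)
    simp at this

end ShiftedArcs

/-- For `k ≥ 3` and `N ≥ 1`, the number of `2`-regular, `k`-noncrossing set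
partitions of `[N]` equals the number of `k`-noncrossing braids over `[N-1]`
containing no loop. -/
theorem two_regular_partitions_card_eq_loopfree_braids (k N : ℕ) (hk : 3 ≤ k) (hN : 1 ≤ N) :
    Nat.card {P : Finpartition (Finset.univ : Finset (Fin N)) //
        IsKNoncrossingPartition k P ∧ IsTwoRegular P}
      = Nat.card {B : Finset (Fin (N - 1) × Fin (N - 1)) //
          IsKNoncrossingBraid k B ∧ ¬ HasLoop B} := by
  obtain ⟨M, rfl⟩ := Nat.exists_eq_add_of_le' hN
  refine Nat.card_congr (Equiv.ofBijective (fun P => ⟨shiftedArcs P.1,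
    ⟨isBraid_shiftedArcs P.1, mt braidHasKCrossing_shiftedArcs_iff.1 P.2.1⟩,
    not_hasLoop_shiftedArcs_iff.2 P.2.2⟩) ⟨fun P Q h => ?_, fun ⟨B, ⟨hB, hcross⟩, hloop⟩ => ?_⟩)
  · exact Subtype.ext (eq_of_shiftedArcs_eq (congrArg Subtype.val h))
  · obtain ⟨P, rfl⟩ := exists_shiftedArcs_eq hB
    exact ⟨⟨P, mt braidHasKCrossing_shiftedArcs_iff.2 hcross,
      not_hasLoop_shiftedArcs_iff.1 hloop⟩, rfl⟩
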